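/- Let A be a C*-algebra. Then V_A = V_A¹ ∪ V_A², where V_A¹ is the set of all a ∈ A for which there exists M ∈ Max(A) such that Z(A) ⊆ M and a + M is a non-zero scalar multiple of the identity in A/M, and V_A² is the set of all a ∈ A for which there exist M₁, M₂ ∈ Max(A) and scalars λ₁ ≠ λ₂ such that Z(A) ⊄ M₁, Z(A) ⊄ M₂, M₁ ∩ Z(A) = M₂ ∩ Z(A), and a + Mᵢ = λᵢ·1_{A/Mᵢ} for i = 1, 2. -/

import Mathlib

open Filter Topology Pointwise

namespace CQP

variable {R : Type*} [NonUnitalRing R] [TopologicalSpace R]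

/-- `I` is a closed two-sided ideal of the (C*-)algebra `S` (a subset of the ambient algebra). -/
def IsIdealOf (I S : Set R) : Prop :=
  I ⊆ S ∧ IsClosed I ∧ (0 : R) ∈ I ∧
  (∀ x ∈ I, ∀ y ∈ I, x + y ∈ I) ∧ (∀ x ∈ I, -x ∈ I) ∧
  (∀ x ∈ I, ∀ a ∈ S, a * x ∈ I ∧ x * a ∈ I)

/-- The centre of the algebra `S`. -/
def centerOf (S : Set R) : Set R := {z ∈ S | ∀ x ∈ S, z * x = x * z}

/-- `e` is a unit for `S` relative to (modulo) the ideal `M`. -/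
def IsRelUnitMod (S M : Set R) (e : R) : Prop :=
  e ∈ S ∧ ∀ x ∈ S, x - x * e ∈ M ∧ x - e * x ∈ M

/-- `M` is a modular maximal ideal of the algebra `S`. -/
def IsModMaxIdealOf (M S : Set R) : Prop :=
  IsIdealOf M S ∧ M ≠ S ∧
  (∀ I, IsIdealOf I S → M ⊆ I → I = M ∨ I = S) ∧
  ∃ e, IsRelUnitMod S M e

/-- The algebra `S` is weakly central. -/
def WeaklyCentral (S : Set R) : Prop :=
  (∀ M, IsModMaxIdealOf M S → ¬ centerOf S ⊆ M) ∧
  (∀ M N, IsModMaxIdealOf M S → IsModMaxIdealOf N S →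
    M ∩ centerOf S = N ∩ centerOf S → M = N)

/-- The algebra `S` has the centre-quotient property: every central element of a quotient
of `S` lifts to a central element of `S` modulo the ideal. -/
def HasCQ (S : Set R) : Prop :=
  ∀ I, IsIdealOf I S → ∀ a ∈ S, (∀ x ∈ S, a * x - x * a ∈ I) →
    ∃ z ∈ centerOf S, a - z ∈ I

/-- `a` is a CQ-element of the algebra `S`. -/
def IsCQElem (S : Set R) (a : R) : Prop :=
  a ∈ S ∧ ∀ I, IsIdealOf I S → (∀ x ∈ S, a * x - x * a ∈ I) →
    ∃ z ∈ centerOf S, a - z ∈ I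

/-- The set of CQ-elements of `S`. -/
def CQset (S : Set R) : Set R := {a | IsCQElem S a}

/-- The set `T_A` of modular maximal ideals witnessing the failure of weak centrality. -/
def Tset (S : Set R) : Set (Set R) :=
  {M | IsModMaxIdealOf M S ∧
    (centerOf S ⊆ M ∨ ∃ N, IsModMaxIdealOf N S ∧ N ≠ M ∧
      ¬ centerOf S ⊆ M ∧ ¬ centerOf S ⊆ N ∧ M ∩ centerOf S = N ∩ centerOf S)}

/-- The closed two-sided ideal of `S` generated by the set `X`. -/
def genIdealOf (S X : Set R) : Set R := ⋂₀ {I | IsIdealOf I S ∧ X ⊆ I}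

/-- The quotient `A/J` (of the full algebra by the ideal `J`) has the centre-quotient
property, expressed via the correspondence between ideals of `A/J` and ideals of `A`
containing `J`. -/
def HasCQmod (J : Set R) : Prop :=
  ∀ I : Set R, IsIdealOf I (Set.univ : Set R) → J ⊆ I → ∀ a : R,
    (∀ x : R, a * x - x * a ∈ I) →
      ∃ z : R, (∀ x : R, z * x - x * z ∈ J) ∧ a - z ∈ I


end CQP

namespace CQP

section Ideals

variable {R : Type*} [NonUnitalRing R] [TopologicalSpace R] {I J : Set R}

namespace IsIdealOf

theorem isClosed (h : IsIdealOf I Set.univ) : IsClosed I := h.2.1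

theorem zero_mem (h : IsIdealOf I Set.univ) : 0 ∈ I := h.2.2.1

theorem add_mem (h : IsIdealOf I Set.univ) {x y : R} (hx : x ∈ I) (hy : y ∈ I) : x + y ∈ I :=
  h.2.2.2.1 x hx y hy

theorem neg_mem (h : IsIdealOf I Set.univ) {x : R} (hx : x ∈ I) : -x ∈ I := h.2.2.2.2.1 x hx

theorem sub_mem (h : IsIdealOf I Set.univ) {x y : R} (hx : x ∈ I) (hy : y ∈ I) : x - y ∈ I :=
  sub_eq_add_neg x y ▸ h.add_mem hx (h.neg_mem hy)

theorem mul_mem_left (h : IsIdealOf I Set.univ) (a : R) {x : R} (hx : x ∈ I) : a * x ∈ I :=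
  (h.2.2.2.2.2 x hx a trivial).1

theorem mul_mem_right (h : IsIdealOf I Set.univ) (a : R) {x : R} (hx : x ∈ I) : x * a ∈ I :=
  (h.2.2.2.2.2 x hx a trivial).2

theorem mem_iff_of_sub_mem (h : IsIdealOf I Set.univ) {x y : R} (hxy : x - y ∈ I) :
    x ∈ I ↔ y ∈ I :=
  ⟨fun hx => by simpa using h.sub_mem hx hxy, fun hy => by simpa using h.add_mem hxy hy⟩

/-- The elements multiplied into `I` by an element that is central modulo `I` form an ideal. -/
theorem colon [ContinuousMul R] (h : IsIdealOf I Set.univ) {d : R}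
    (hd : ∀ x, d * x - x * d ∈ I) : IsIdealOf {x | x * d ∈ I} Set.univ := by
  refine ⟨Set.subset_univ _, h.isClosed.preimage (continuous_mul_const d), ?_, ?_, ?_, ?_⟩
  · simpa using h.zero_mem
  · intro x hx y hy
    simpa [add_mul] using h.add_mem hx hy
  · intro x hx
    simpa using h.neg_mem hx
  · intro x hx a _
    refine ⟨by simpa [mul_assoc] using h.mul_mem_left a hx, ?_⟩
    have := h.sub_mem (h.mul_mem_right a hx) (h.mul_mem_left x (hd a))
    simpa [mul_sub, mul_assoc] using this

end IsIdealOf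

theorem isIdealOf_closure [IsTopologicalRing R] (h0 : (0 : R) ∈ I)
    (hadd : ∀ x ∈ I, ∀ y ∈ I, x + y ∈ I) (hneg : ∀ x ∈ I, -x ∈ I)
    (hl : ∀ x ∈ I, ∀ a, a * x ∈ I) (hr : ∀ x ∈ I, ∀ a, x * a ∈ I) :
    IsIdealOf (closure I) Set.univ :=
  ⟨Set.subset_univ _, isClosed_closure, subset_closure h0,
    fun _ hx _ hy => map_mem_closure₂ continuous_add hx hy hadd,
    fun _ hx => map_mem_closure continuous_neg hx hneg,
    fun _ hx a _ => ⟨map_mem_closure (continuous_const_mul a) hx fun x hx => hl x hx a,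
      map_mem_closure (f := (· * a)) (continuous_mul_const a) hx
        fun x hx => hr x hx a⟩⟩

end Ideals

section Unital

variable {U : Type*} [NormedRing U] [CompleteSpace U] {I J K M : Set U}

theorem one_mem_of_mem_closure (hl : ∀ x ∈ I, ∀ a, a * x ∈ I) (h : (1 : U) ∈ closure I) :
    (1 : U) ∈ I := by
  obtain ⟨x, hx, hd⟩ := Metric.mem_closure_iff.1 h 1 one_pos
  rw [dist_eq_norm] at hd
  obtain ⟨u, hu⟩ := isUnit_one_sub_of_norm_lt_one hd
  rw [sub_sub_cancel] at hu
  simpa [← hu] using hl x hx ↑u⁻¹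

theorem IsIdealOf.one_mem_of_norm_lt (h : IsIdealOf I Set.univ) {x : U} (hx : x ∈ I)
    (hd : ‖1 - x‖ < 1) : (1 : U) ∈ I := by
  obtain ⟨u, hu⟩ := isUnit_one_sub_of_norm_lt_one hd
  rw [sub_sub_cancel] at hu
  simpa [← hu] using h.mul_mem_left ↑u⁻¹ hx

/-- `M` is maximal among the proper closed ideals of a unital algebra. -/
def IsMaxIdeal (M : Set U) : Prop :=
  IsIdealOf M Set.univ ∧ (1 : U) ∉ M ∧
    ∀ J, IsIdealOf J Set.univ → M ⊆ J → (1 : U) ∉ J → J ⊆ M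

theorem exists_isMaxIdeal (hI : IsIdealOf I Set.univ) (h1 : (1 : U) ∉ I) :
    ∃ M, IsMaxIdeal M ∧ I ⊆ M := by
  obtain ⟨M, hIM, hM⟩ := zorn_subset_nonempty {J : Set U | IsIdealOf J Set.univ ∧ (1 : U) ∉ J}
    (fun c hc hchain ⟨J₀, hJ₀⟩ => by
      have hl : ∀ x ∈ ⋃₀ c, ∀ a, a * x ∈ ⋃₀ c := fun x ⟨J, hJ, hx⟩ a =>
        ⟨J, hJ, (hc hJ).1.mul_mem_left a hx⟩
      refine ⟨closure (⋃₀ c), ⟨isIdealOf_closure ⟨J₀, hJ₀, (hc hJ₀).1.zero_mem⟩ ?_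
        (fun x ⟨J, hJ, hx⟩ => ⟨J, hJ, (hc hJ).1.neg_mem hx⟩) hl
        (fun x ⟨J, hJ, hx⟩ a => ⟨J, hJ, (hc hJ).1.mul_mem_right a hx⟩), ?_⟩,
        fun J hJ => (Set.subset_sUnion_of_mem hJ).trans subset_closure⟩
      · rintro x ⟨J, hJ, hx⟩ y ⟨K, hK, hy⟩
        obtain h | h := hchain.total hJ hK
        · exact ⟨K, hK, (hc hK).1.add_mem (h hx) hy⟩
        · exact ⟨J, hJ, (hc hJ).1.add_mem hx (h hy)⟩
      · intro h
        obtain ⟨J, hJ, h1J⟩ := one_mem_of_mem_closure hl h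
        exact (hc hJ).2 h1J) I ⟨hI, h1⟩
  exact ⟨M, ⟨hM.prop.1, hM.prop.2, fun J hJ hMJ hJ1 => hM.le_of_ge ⟨hJ, hJ1⟩ hMJ⟩, hIM⟩

namespace IsMaxIdeal

theorem exists_one_sub_mem (hM : IsMaxIdeal M) (hK : IsIdealOf K Set.univ) (h : ¬ K ⊆ M) :
    ∃ k ∈ K, 1 - k ∈ M := by
  obtain ⟨hI, h1, hmax⟩ := hM
  have hl : ∀ x ∈ K + M, ∀ a, a * x ∈ K + M := by
    rintro _ ⟨k, hk, m, hm, rfl⟩ a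
    exact ⟨a * k, hK.mul_mem_left a hk, a * m, hI.mul_mem_left a hm, (mul_add ..).symm⟩
  have hKM : IsIdealOf (closure (K + M)) Set.univ := by
    refine isIdealOf_closure ⟨0, hK.zero_mem, 0, hI.zero_mem, add_zero 0⟩ ?_ ?_ hl ?_
    · rintro _ ⟨k, hk, m, hm, rfl⟩ _ ⟨k', hk', m', hm', rfl⟩
      exact ⟨k + k', hK.add_mem hk hk', m + m', hI.add_mem hm hm', add_add_add_comm ..⟩
    · rintro _ ⟨k, hk, m, hm, rfl⟩
      exact ⟨-k, hK.neg_mem hk, -m, hI.neg_mem hm, (neg_add ..).symm⟩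
    · rintro _ ⟨k, hk, m, hm, rfl⟩ a
      exact ⟨k * a, hK.mul_mem_right a hk, m * a, hI.mul_mem_right a hm, (add_mul ..).symm⟩
  have hone : (1 : U) ∈ closure (K + M) := by
    by_contra hone
    exact h fun k hk => hmax _ hKM
      (fun m hm => subset_closure (Set.mem_add.2 ⟨0, hK.zero_mem, m, hm, zero_add m⟩)) hone
      (subset_closure (Set.mem_add.2 ⟨k, hk, 0, hI.zero_mem, add_zero k⟩))
  obtain ⟨k, hk, m, hm, hkm⟩ := one_mem_of_mem_closure hl hone
  exact ⟨k, hk, by simpa [← hkm] using hm⟩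

end IsMaxIdeal

end Unital

/-- Maximal ideals are prime with respect to elements that are central modulo the ideal. -/
theorem IsMaxIdeal.mem_of_mul_mem {U : Type*} [NormedRing U] {M : Set U}
    (hM : IsMaxIdeal M) {c d : U} (hd : ∀ x, d * x - x * d ∈ M)
    (hcd : c * d ∈ M) (hdM : d ∉ M) : c ∈ M :=
  hM.2.2 _ (hM.1.colon hd) (fun _ hx => hM.1.mul_mem_right d hx)
    (by simpa using hdM) hcd

section CStar

variable {U : Type*} [CStarAlgebra U] {I M : Set U}

/-- Closed ideals of C*-algebras, defined without reference to scalars, are closed under scalar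
multiplication. -/
theorem IsIdealOf.smul_mem {A : Type*} [NonUnitalCStarAlgebra A] {I : Set A}
    (h : IsIdealOf I Set.univ) (c : ℂ) {x : A} (hx : x ∈ I) : c • x ∈ I := by
  let _ := CStarAlgebra.spectralOrder A
  let _ := CStarAlgebra.spectralOrderedRing A
  refine h.isClosed.mem_of_tendsto
    (((CStarAlgebra.increasingApproximateUnit A).tendsto_mul_left x).const_smul c)
    (.of_forall fun e => ?_)
  rw [← mul_smul_comm]
  exact h.mul_mem_right _ hx

theorem IsIdealOf.not_smul_one_mem (h : IsIdealOf I Set.univ) (h1 : (1 : U) ∉ I) {c : ℂ}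
    (hc : c ≠ 0) : c • (1 : U) ∉ I := fun hx => h1 <| by
  simpa [smul_smul, hc] using h.smul_mem c⁻¹ hx

/-- Closed ideals of C*-algebras are self-adjoint. -/
theorem IsIdealOf.star_mem (h : IsIdealOf I Set.univ) {x : U} (hx : x ∈ I) : star x ∈ I := by
  refine h.isClosed.closure_subset (Metric.mem_closure_iff.2 fun ε hε => ?_)
  obtain ⟨δ, hδ, hδε⟩ : ∃ δ : ℝ, 0 < δ ∧ δ < ε ^ 2 := exists_between (by positivity)
  have hpos : ∀ s : ℝ, 0 < s ^ 2 + δ ^ 2 := fun s => by positivity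
  have hcont : Continuous fun s : ℝ => s / (s ^ 2 + δ ^ 2) :=
    continuous_id.div (by fun_prop) fun s => (hpos s).ne'
  have hcont' : Continuous fun s : ℝ => δ ^ 2 / (s ^ 2 + δ ^ 2) :=
    continuous_const.div (by fun_prop) fun s => (hpos s).ne'
  have hcont₁ : Continuous fun s : ℝ => s / (s ^ 2 + δ ^ 2) * s := hcont.mul continuous_id
  have hcont₁' : Continuous fun s : ℝ => δ ^ 2 / (s ^ 2 + δ ^ 2) * s := hcont'.mul continuous_id
  have hp : IsSelfAdjoint (star x * x) := .star_mul_self x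
  set p := star x * x with hp_def
  set e := cfc (fun s : ℝ => s / (s ^ 2 + δ ^ 2)) p
  set r := cfc (fun s : ℝ => δ ^ 2 / (s ^ 2 + δ ^ 2)) p with hr_def
  have hr : r = 1 - e * p := by
    have hep : e * p = cfc (fun s : ℝ => s / (s ^ 2 + δ ^ 2) * s) p := by
      rw [cfc_mul _ _ p hcont.continuousOn, cfc_id' ℝ p]
    rw [eq_sub_iff_add_eq, hep, hr_def, ← cfc_add _ _ _ hcont'.continuousOn
      hcont₁.continuousOn, ← cfc_const_one ℝ p]
    refine cfc_congr fun s _ => ?_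
    have := (hpos s).ne'
    field_simp
    ring
  have hrs : IsSelfAdjoint r := cfc_predicate _ _
  refine ⟨e * p * star x, h.mul_mem_right _ (h.mul_mem_left _ (h.mul_mem_left _ hx)), ?_⟩
  have hx' : star x - e * p * star x = r * star x := by rw [hr, sub_mul, one_mul]
  rw [dist_eq_norm, hx']
  refine lt_of_pow_lt_pow_left₀ 2 hε.le (lt_of_le_of_lt ?_ hδε)
  have hrpr : r * star x * star (r * star x) =
      cfc (fun s : ℝ => δ ^ 2 / (s ^ 2 + δ ^ 2) * s * (δ ^ 2 / (s ^ 2 + δ ^ 2))) p := by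
    rw [cfc_mul _ _ p hcont₁'.continuousOn hcont'.continuousOn,
      cfc_mul _ _ p hcont'.continuousOn, cfc_id' ℝ p, star_mul, star_star, hrs.star_eq, hp_def]
    simp only [mul_assoc, r, p]
  rw [sq, ← CStarRing.norm_self_mul_star, hrpr]
  refine norm_cfc_le hδ.le fun s _ => ?_
  have h1 : δ ^ 2 / (s ^ 2 + δ ^ 2) ≤ 1 := (div_le_one (hpos s)).2 (by nlinarith [sq_nonneg s])
  have h0 : 0 ≤ δ ^ 2 / (s ^ 2 + δ ^ 2) := div_nonneg (by positivity) (hpos s).le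
  have h2 : δ ^ 2 / (s ^ 2 + δ ^ 2) * |s| ≤ δ := by
    rw [div_mul_eq_mul_div, div_le_iff₀ (hpos s)]
    nlinarith [sq_nonneg (|s| - δ), sq_abs s, abs_nonneg s]
  rw [Real.norm_eq_abs, abs_mul, abs_mul, abs_of_nonneg h0]
  calc _ ≤ δ * 1 := by gcongr
    _ = δ := mul_one δ

/-- The elements that are central modulo the closed ideal `I` form a C*-subalgebra. -/
def centralMod (hI : IsIdealOf I Set.univ) : StarSubalgebra ℝ U where
  carrier := {b | ∀ x, b * x - x * b ∈ I}
  mul_mem' {b c} hb hc x := by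
    have := hI.add_mem (hI.mul_mem_left b (hc x)) (hI.mul_mem_right c (hb x))
    convert this using 1
    noncomm_ring
  add_mem' {b c} hb hc x := by
    have := hI.add_mem (hb x) (hc x)
    convert this using 1
    noncomm_ring
  algebraMap_mem' r x := by simpa [Algebra.commutes] using hI.zero_mem
  star_mem' {b} hb x := by
    have := hI.neg_mem (hI.star_mem (hb (star x)))
    simpa using this

theorem smul_mem_centralMod {hI : IsIdealOf I Set.univ} (c : ℂ) {b : U}
    (hb : b ∈ centralMod hI) : c • b ∈ centralMod hI := fun x => by
  rw [smul_mul_assoc, mul_smul_comm, ← smul_sub]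
  exact hI.smul_mem c (hb x)

theorem mem_centralMod {hI : IsIdealOf I Set.univ} {b : U} :
    b ∈ centralMod hI ↔ ∀ x, b * x - x * b ∈ I := Iff.rfl

instance isClosed_centralMod (hI : IsIdealOf I Set.univ) :
    IsClosed (centralMod hI : Set U) := by
  have : (centralMod hI : Set U) = ⋂ x, {b | b * x - x * b ∈ I} := by
    ext b
    simp [mem_centralMod]
  rw [this]
  exact isClosed_iInter fun x => hI.isClosed.preimage (by fun_prop)

theorem cfc_mem_centralMod (hI : IsIdealOf I Set.univ) (f : ℝ → ℝ) {b : U}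
    (hb : b ∈ centralMod hI) : cfc f b ∈ centralMod hI :=
  cfc_mem (𝕜' := ℝ) f hb

theorem continuous_cfc_family {F : ℝ → ℝ → ℝ} (hF : ∀ s, Continuous (F s))
    (hlip : ∀ s s' t, |F s t - F s' t| ≤ |s - s'|) (b : U) :
    Continuous fun s => cfc (F s) b := by
  refine (LipschitzWith.of_dist_le_mul (K := 1) fun s s' => ?_).continuous
  rw [dist_eq_norm, ← cfc_sub _ _ b (hF s).continuousOn (hF s').continuousOn]
  simpa [Real.dist_eq] using norm_cfc_le (abs_nonneg (s - s')) fun t _ => hlip s s' t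

namespace IsMaxIdeal

theorem exists_real_sub_mem (hM : IsMaxIdeal M) {b : U} (hb : IsSelfAdjoint b)
    (hbM : b ∈ centralMod hM.1) : ∃ s : ℝ, b - algebraMap ℝ U s ∈ M := by
  have hf : ∀ s : ℝ, Continuous fun t : ℝ => max (t - s) 0 := fun s => by fun_prop
  have hg : ∀ s : ℝ, Continuous fun t : ℝ => min (t - s) 0 := fun s => by fun_prop
  have hfc : Continuous fun s : ℝ => cfc (fun t : ℝ => max (t - s) 0) b :=
    continuous_cfc_family hf (fun s s' t => by
      simpa [abs_sub_comm] using abs_max_sub_max_le_max (t - s) 0 (t - s') 0) b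
  have hgc : Continuous fun s : ℝ => cfc (fun t : ℝ => min (t - s) 0) b :=
    continuous_cfc_family hg (fun s s' t => by
      simpa [abs_sub_comm] using abs_min_sub_min_le_max (t - s) 0 (t - s') 0) b
  have hspec : ∀ t ∈ spectrum ℝ b, |t| ≤ ‖b‖ := fun t ht => by
    have : Nontrivial U := ⟨1, 0, fun h => hM.2.1 (h ▸ hM.1.zero_mem)⟩
    simpa using spectrum.norm_le_norm_of_mem ht
  set S : Set ℝ := {s | cfc (fun t : ℝ => max (t - s) 0) b ∈ M}
  have hS : IsClosed S := hM.1.isClosed.preimage hfc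
  have hne : S.Nonempty := by
    refine ⟨‖b‖, ?_⟩
    have : cfc (fun t : ℝ => max (t - ‖b‖) 0) b = cfc (fun _ : ℝ => (0 : ℝ)) b :=
      cfc_congr fun t ht => max_eq_right (sub_nonpos.2 ((le_abs_self t).trans (hspec t ht)))
    simpa [S, this] using hM.1.zero_mem
  have hbdd : BddBelow S := by
    refine ⟨-‖b‖, fun s hs => ?_⟩
    by_contra! hlt
    have hpos : ∀ t ∈ spectrum ℝ b, 0 < t - s := fun t ht => by
      have := (abs_le.1 (hspec t ht)).1
      linarith
    have hinv : ContinuousOn (fun t : ℝ => (t - s)⁻¹) (spectrum ℝ b) :=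
      ContinuousOn.inv₀ (by fun_prop) fun t ht => (hpos t ht).ne'
    have : cfc (fun t : ℝ => (t - s)⁻¹) b * cfc (fun t : ℝ => max (t - s) 0) b = 1 := by
      rw [← cfc_mul _ _ b hinv (hf s).continuousOn, ← cfc_const_one ℝ b]
      refine cfc_congr fun t ht => ?_
      rw [max_eq_left (hpos t ht).le, inv_mul_cancel₀ (hpos t ht).ne']
    exact hM.2.1 (this ▸ hM.1.mul_mem_left _ hs)
  refine ⟨sInf S, ?_⟩
  have hfS : cfc (fun t : ℝ => max (t - sInf S) 0) b ∈ M := hS.csInf_mem hne hbdd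
  have hT : IsClosed {s : ℝ | cfc (fun t : ℝ => min (t - s) 0) b ∈ M} :=
    hM.1.isClosed.preimage hgc
  have hgS : cfc (fun t : ℝ => min (t - sInf S) 0) b ∈ M := by
    have hsub : Set.Iio (sInf S) ⊆ {s : ℝ | cfc (fun t : ℝ => min (t - s) 0) b ∈ M} := by
      intro s hs
      refine hM.mem_of_mul_mem (cfc_mem_centralMod hM.1 (fun t : ℝ => max (t - s) 0) hbM) ?_
        fun h => notMem_of_lt_csInf hs hbdd h
      rw [← cfc_mul _ _ b (hg s).continuousOn (hf s).continuousOn]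
      have : (fun t : ℝ => min (t - s) 0 * max (t - s) 0) = fun _ => 0 := by
        ext t
        simp [min_mul_max]
      simpa [this] using hM.1.zero_mem
    exact hT.closure_subset_iff.2 hsub (by simp)
  have := hM.1.add_mem hfS hgS
  rw [← cfc_add b _ _ (hf _).continuousOn (hg _).continuousOn] at this
  simp only [max_add_min, add_zero] at this
  rwa [cfc_sub _ _ b, cfc_id' ℝ b, cfc_const _ b] at this

theorem exists_sub_smul_mem (hM : IsMaxIdeal M) {b : U} (hb : ∀ x, b * x - x * b ∈ M) :
    ∃ c : ℂ, b - c • 1 ∈ M := by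
  have hbM : b ∈ centralMod hM.1 := hb
  have hre : (b + star b) ∈ centralMod hM.1 := add_mem hbM (star_mem hbM)
  have him : (Complex.I • (b - star b)) ∈ centralMod hM.1 :=
    smul_mem_centralMod _ (sub_mem hbM (star_mem hbM))
  obtain ⟨s, hs⟩ := hM.exists_real_sub_mem (.add_star_self b) hre
  obtain ⟨t, ht⟩ := hM.exists_real_sub_mem (b := Complex.I • (b - star b))
    (by simp [IsSelfAdjoint, smul_sub, neg_add_eq_sub]) him
  refine ⟨(s - Complex.I * t) / 2, ?_⟩
  have := hM.1.smul_mem (1 / 2) (hM.1.sub_mem hs (hM.1.smul_mem Complex.I ht))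
  convert this using 1
  simp only [Algebra.algebraMap_eq_smul_one, smul_sub, smul_smul, ← mul_assoc, Complex.I_mul_I,
    smul_add, ← Complex.coe_smul s, ← Complex.coe_smul t]
  module

end IsMaxIdeal

theorem IsIdealOf.mem_of_isSelfAdjoint (hI : IsIdealOf I Set.univ) {b : U}
    (hb : IsSelfAdjoint b) (hbI : b ∈ centralMod hI)
    (h : ∀ M, IsMaxIdeal M → I ⊆ M → b ∈ M) : b ∈ I := by
  refine hI.isClosed.closure_subset (Metric.mem_closure_iff.2 fun ε hε => ?_)
  obtain ⟨δ, hδ, hδε⟩ := exists_between hε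
  have hpos : ∀ t : ℝ, 0 < max (t ^ 2) (δ ^ 2) := fun t => lt_max_of_lt_right (by positivity)
  have hk : Continuous fun t : ℝ => t / max (t ^ 2) (δ ^ 2) :=
    continuous_id.div (by fun_prop) fun t => (hpos t).ne'
  have hkb : Continuous fun t : ℝ => t / max (t ^ 2) (δ ^ 2) * t := hk.mul continuous_id
  have hg : Continuous fun t : ℝ => max (t - δ) 0 + min (t + δ) 0 := by fun_prop
  refine ⟨cfc (fun t : ℝ => max (t - δ) 0 + min (t + δ) 0) b, ?_, ?_⟩
  · set g := cfc (fun t : ℝ => max (t - δ) 0 + min (t + δ) 0) b with hg_def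
    by_contra hgI
    have hgc : g ∈ centralMod hI := cfc_mem_centralMod hI _ hbI
    obtain ⟨M, hM, hIM⟩ := exists_isMaxIdeal (hI.colon hgc) (by simpa using hgI)
    have hbM : b ∈ M := h M hM (Set.Subset.trans (fun x hx => hI.mul_mem_right g hx) hIM)
    have hmem : 1 - cfc (fun t : ℝ => t / max (t ^ 2) (δ ^ 2)) b * b ∈ M := by
      refine hIM ?_
      have : (1 - cfc (fun t : ℝ => t / max (t ^ 2) (δ ^ 2)) b * b) * g = 0 := by
        nth_rw 2 [← cfc_id' ℝ b]
        rw [sub_mul, one_mul, sub_eq_zero, ← cfc_mul _ _ b hk.continuousOn, hg_def,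
          ← cfc_mul _ _ b hkb.continuousOn hg.continuousOn]
        refine cfc_congr fun t _ => ?_
        by_cases ht : δ ^ 2 ≤ t ^ 2
        · have : t ^ 2 ≠ 0 := (lt_of_lt_of_le (by positivity) ht).ne'
          rw [max_eq_left ht, div_mul_eq_mul_div, ← sq, div_self this, one_mul]
        · have := abs_lt.1 (lt_of_pow_lt_pow_left₀ 2 hδ.le (by simpa using ht) : |t| < δ)
          rw [max_eq_right (by linarith), min_eq_right (by linarith)]
          simp
      simpa [this] using hI.zero_mem
    exact hM.2.1 ((hM.1.mem_iff_of_sub_mem hmem).2 (hM.1.mul_mem_left _ hbM))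
  · rw [dist_eq_norm]
    nth_rw 1 [← cfc_id' ℝ b]
    rw [← cfc_sub _ _ b (by fun_prop) hg.continuousOn]
    refine (norm_cfc_le hδ.le fun t _ => ?_).trans_lt hδε
    rw [Real.norm_eq_abs, abs_le]
    rcases max_cases (t - δ) 0 with ⟨h₁, _⟩ | ⟨h₁, _⟩ <;>
      rcases min_cases (t + δ) 0 with ⟨h₂, _⟩ | ⟨h₂, _⟩ <;>
      rw [h₁, h₂] <;> constructor <;> linarith

/-- An element that is central modulo `I` and lies in all maximal ideals above `I` lies in `I`. -/
theorem IsIdealOf.mem_of_forall_isMaxIdeal (hI : IsIdealOf I Set.univ) {b : U}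
    (hb : ∀ x, b * x - x * b ∈ I) (h : ∀ M, IsMaxIdeal M → I ⊆ M → b ∈ M) : b ∈ I := by
  have hbI : b ∈ centralMod hI := hb
  have hre : b + star b ∈ I := hI.mem_of_isSelfAdjoint (.add_star_self b)
    (AddMemClass.add_mem hbI (StarMemClass.star_mem hbI))
    fun M hM hIM => hM.1.add_mem (h M hM hIM) (hM.1.star_mem (h M hM hIM))
  have him : Complex.I • (b - star b) ∈ I := hI.mem_of_isSelfAdjoint
    (by simp [IsSelfAdjoint, smul_sub, neg_add_eq_sub])
    (smul_mem_centralMod _ (_root_.sub_mem hbI (StarMemClass.star_mem hbI)))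
    fun M hM hIM => hM.1.smul_mem _ (hM.1.sub_mem (h M hM hIM) (hM.1.star_mem (h M hM hIM)))
  have := hI.smul_mem (1 / 2) (hI.sub_mem hre (hI.smul_mem Complex.I him))
  convert this using 1
  simp only [smul_sub, smul_smul, Complex.I_mul_I, smul_add]
  module

variable (U) in
/-- The centre of a C*-algebra as a star subalgebra. -/
abbrev starCenter : StarSubalgebra ℂ U := StarSubalgebra.centralizer ℂ Set.univ

theorem mem_starCenter {z : U} : z ∈ starCenter U ↔ ∀ x, z * x = x * z := by
  simp only [starCenter, StarSubalgebra.mem_centralizer_iff, Set.mem_univ, true_implies]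
  exact ⟨fun h x => (h x).1.symm, fun h x => ⟨(h x).symm, (h (star x)).symm⟩⟩

instance isClosed_starCenter : IsClosed (starCenter U : Set U) := by
  have : (starCenter U : Set U) = ⋂ x, {z | z * x = x * z} := by
    ext z
    rw [SetLike.mem_coe, mem_starCenter, Set.mem_iInter]
    rfl
  rw [this]
  exact isClosed_iInter fun x => isClosed_eq (by fun_prop) (by fun_prop)

noncomputable instance : CommCStarAlgebra (starCenter U) where
  mul_comm a b := Subtype.ext (mem_starCenter.1 a.2 b)

open WeakDual

/-- The joint spectrum above `I` of the centre and of an element `a`: a character `χ` and a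
scalar `c` such that modulo some maximal ideal above `I` the centre acts through `χ` and `a`
equals `c`. -/
def jointSpectrum (I : Set U) (a : U) : Set (characterSpace ℂ (starCenter U) × ℂ) :=
  {p | ∃ M, IsMaxIdeal M ∧ I ⊆ M ∧ (∀ z : starCenter U, (z : U) - p.1 z • 1 ∈ M) ∧
    a - p.2 • 1 ∈ M}

theorem IsMaxIdeal.exists_mem_jointSpectrum (hM : IsMaxIdeal M) (hIM : I ⊆ M) {a : U}
    (ha : ∀ x, a * x - x * a ∈ I) :
    ∃ p ∈ jointSpectrum I a, (∀ z : starCenter U, (z : U) - p.1 z • 1 ∈ M) ∧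
      a - p.2 • 1 ∈ M := by
  obtain ⟨c, hc⟩ := hM.exists_sub_smul_mem fun x => hIM (ha x)
  let J : Ideal (starCenter U) :=
    { carrier := {z | (z : U) ∈ M}
      add_mem' := fun hx hy => hM.1.add_mem hx hy
      zero_mem' := hM.1.zero_mem
      smul_mem' := fun c x hx => hM.1.mul_mem_left (c : U) hx }
  have hJ : J ≠ ⊤ := fun h => hM.2.1 ((Ideal.eq_top_iff_one J).1 h)
  obtain ⟨K, hK, hJK⟩ := J.exists_le_maximal hJ
  have hz : ∀ z : starCenter U, (z : U) - K.toCharacterSpace z • 1 ∈ M := fun z => by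
    obtain ⟨d, hd⟩ := hM.exists_sub_smul_mem (b := z) fun x => by
      simpa [mem_starCenter.1 z.2 x] using hM.1.zero_mem
    have hmem : z - d • (1 : starCenter U) ∈ J := hd
    have := K.toCharacterSpace_apply_eq_zero_of_mem (hJK hmem)
    rw [map_sub, map_smul, map_one, smul_eq_mul, mul_one, sub_eq_zero] at this
    rwa [this]
  exact ⟨(K.toCharacterSpace, c), ⟨M, hM, hIM, hz, hc⟩, hz, hc⟩

theorem norm_le_of_sub_smul_mem (hM : IsMaxIdeal M) {a : U} {c : ℂ} (h : a - c • 1 ∈ M) :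
    ‖c‖ ≤ ‖a‖ := by
  by_contra! hlt
  have hc : c ≠ 0 := norm_pos_iff.1 ((norm_nonneg a).trans_lt hlt)
  refine hM.2.1 (hM.1.one_mem_of_norm_lt (hM.1.smul_mem (-c⁻¹) h) ?_)
  have : (1 : U) - -c⁻¹ • (a - c • 1) = c⁻¹ • a := by
    rw [smul_sub, smul_smul, neg_mul, inv_mul_cancel₀ hc]
    module
  rw [this, norm_smul, norm_inv, inv_mul_lt_iff₀ (norm_pos_iff.2 hc), mul_one]
  exact hlt

theorem isClosed_jointSpectrum (I : Set U) (a : U) :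
    IsClosed (jointSpectrum I a) := by
  refine isClosed_of_closure_subset fun p hp => ?_
  have : (𝓝[jointSpectrum I a] p).NeBot := mem_closure_iff_nhdsWithin_neBot.1 hp
  have hself : ∀ᶠ q in 𝓝[jointSpectrum I a] p, q ∈ jointSpectrum I a := self_mem_nhdsWithin
  choose! N hN hIN hNz hNa using fun (q) (hq : q ∈ jointSpectrum I a) => hq
  set L : Set U := {x | ∀ ε > 0, ∀ᶠ q in 𝓝[jointSpectrum I a] p, ∃ m ∈ N q, ‖x - m‖ < ε}
    with hL_def
  have hmul : ∀ x y : U, ∀ ε > 0, ‖x‖ < ε / (‖y‖ + 1) → ‖x‖ * ‖y‖ < ε := fun x y ε hε h => by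
    rw [lt_div_iff₀ (by positivity)] at h
    nlinarith [norm_nonneg x]
  have hL : IsIdealOf L Set.univ := by
    refine ⟨Set.subset_univ _, isClosed_of_closure_subset fun x hx ε hε => ?_, fun ε hε => ?_,
      fun x hx y hy ε hε => ?_, fun x hx ε hε => ?_, fun x hx y _ => ⟨fun ε hε => ?_,
      fun ε hε => ?_⟩⟩
    · obtain ⟨y, hy, hxy⟩ := Metric.mem_closure_iff.1 hx (ε / 2) (half_pos hε)
      filter_upwards [hy (ε / 2) (half_pos hε)] with q ⟨m, hm, hlt⟩
      refine ⟨m, hm, ?_⟩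
      rw [dist_eq_norm] at hxy
      linarith [norm_sub_le_norm_sub_add_norm_sub x y m]
    · filter_upwards [hself] with q hq
      exact ⟨0, (hN q hq).1.zero_mem, by simpa using hε⟩
    · filter_upwards [hself, hx _ (half_pos hε), hy _ (half_pos hε)] with q hq
        ⟨m, hm, hxm⟩ ⟨n, hn, hyn⟩
      refine ⟨m + n, (hN q hq).1.add_mem hm hn, ?_⟩
      rw [add_sub_add_comm]
      linarith [norm_add_le (x - m) (y - n)]
    · filter_upwards [hself, hx ε hε] with q hq ⟨m, hm, hxm⟩
      refine ⟨-m, (hN q hq).1.neg_mem hm, ?_⟩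
      rwa [neg_sub_neg, norm_sub_rev]
    · filter_upwards [hself, hx (ε / (‖y‖ + 1)) (by positivity)] with q hq ⟨m, hm, hxm⟩
      refine ⟨y * m, (hN q hq).1.mul_mem_left y hm, ?_⟩
      rw [← mul_sub]
      exact (norm_mul_le _ _).trans_lt (by rw [mul_comm]; exact hmul _ _ _ hε hxm)
    · filter_upwards [hself, hx (ε / (‖y‖ + 1)) (by positivity)] with q hq ⟨m, hm, hxm⟩
      refine ⟨m * y, (hN q hq).1.mul_mem_right y hm, ?_⟩
      rw [← sub_mul]
      exact (norm_mul_le _ _).trans_lt (hmul _ _ _ hε hxm)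
  have h1 : (1 : U) ∉ L := fun h => by
    obtain ⟨q, hq, m, hm, hlt⟩ := (hself.and (h 1 one_pos)).exists
    exact (hN q hq).2.1 ((hN q hq).1.one_mem_of_norm_lt hm hlt)
  have hlim : ∀ (x : U) (f : characterSpace ℂ (starCenter U) × ℂ → ℂ), Continuous f →
      (∀ q ∈ jointSpectrum I a, x - f q • 1 ∈ N q) → x - f p • 1 ∈ L := by
    intro x f hf hx ε hε
    have hsmul : Continuous fun q => ‖(f q - f p) • (1 : U)‖ := by fun_prop
    have : ∀ᶠ q in 𝓝[jointSpectrum I a] p, ‖(f q - f p) • (1 : U)‖ < ε :=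
      nhdsWithin_le_nhds (hsmul.continuousAt.eventually_lt continuousAt_const (by simpa using hε))
    filter_upwards [hself, this] with q hq hlt
    refine ⟨_, hx q hq, ?_⟩
    convert hlt using 2
    module
  obtain ⟨M, hM, hLM⟩ := exists_isMaxIdeal hL h1
  refine ⟨M, hM, fun x hx => hLM fun ε hε => ?_, fun z => hLM ?_, hLM ?_⟩
  · filter_upwards [hself] with q hq
    exact ⟨x, hIN q hq hx, by simpa using hε⟩
  · exact hlim z (fun q => q.1 z) ((gelfandTransform ℂ (starCenter U) z).continuous.comp
      continuous_fst) fun q hq => hNz q hq z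
  · exact hlim a Prod.snd continuous_snd fun q hq => hNa q hq

theorem isCompact_jointSpectrum (I : Set U) (a : U) :
    IsCompact (jointSpectrum I a) :=
  (isCompact_univ.prod (ProperSpace.isCompact_closedBall (0 : ℂ) ‖a‖)).of_isClosed_subset
    (isClosed_jointSpectrum I a) fun _ ⟨_, hM, _, _, ha⟩ =>
      ⟨trivial, by simpa using norm_le_of_sub_smul_mem hM ha⟩

/-- If an element central modulo `I` does not lift to a central element, then two maximal ideals
above `I` with the same central part give it different values. -/
theorem exists_isMaxIdeal_pair (hI : IsIdealOf I Set.univ) {a : U}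
    (ha : ∀ x, a * x - x * a ∈ I)
    (hlift : ∀ z, (∀ x, z * x = x * z) → a - z ∉ I) :
    ∃ M₁ M₂ : Set U, ∃ c₁ c₂ : ℂ, IsMaxIdeal M₁ ∧ IsMaxIdeal M₂ ∧ c₁ ≠ c₂ ∧
      a - c₁ • 1 ∈ M₁ ∧ a - c₂ • 1 ∈ M₂ ∧
      ∀ z, (∀ x, z * x = x * z) → (z ∈ M₁ ↔ z ∈ M₂) := by
  by_contra! hcon
  have hinj : Function.Injective fun p : jointSpectrum I a => p.1.1 := by
    rintro ⟨⟨χ, c₁⟩, M₁, hM₁, -, hz₁, ha₁⟩ ⟨⟨χ', c₂⟩, M₂, hM₂, -, hz₂, ha₂⟩ (rfl : χ = χ')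
    by_contra hne
    obtain ⟨z, hz, hz'⟩ := hcon M₁ M₂ c₁ c₂ hM₁ hM₂ (by rintro rfl; exact hne rfl) ha₁ ha₂
    have key : ∀ N, IsMaxIdeal N → (∀ z : starCenter U, (z : U) - χ z • 1 ∈ N) →
        (z ∈ N ↔ χ ⟨z, mem_starCenter.2 hz⟩ = 0) := fun N hN h => by
      rw [hN.1.mem_iff_of_sub_mem (h ⟨z, mem_starCenter.2 hz⟩)]
      refine ⟨fun h' => by_contra fun h0 => hN.1.not_smul_one_mem hN.2.1 h0 h', fun h' => ?_⟩
      simpa [h'] using hN.1.zero_mem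
    have := (key M₁ hM₁ hz₁).trans (key M₂ hM₂ hz₂).symm
    tauto
  have : CompactSpace (jointSpectrum I a) :=
    isCompact_iff_compactSpace.1 (isCompact_jointSpectrum I a)
  have hemb : IsClosedEmbedding fun p : jointSpectrum I a => p.1.1 :=
    .of_continuous_injective_isClosedMap (by fun_prop) hinj (by
      refine Continuous.isClosedMap (by fun_prop))
  obtain ⟨g, hg⟩ := ContinuousMap.exists_extension' hemb
    ⟨fun p : jointSpectrum I a => p.1.2, by fun_prop⟩
  obtain ⟨z, rfl⟩ := (gelfandTransform_bijective (starCenter U)).2 g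
  have hzc := mem_starCenter.1 z.2
  refine hlift z hzc (hI.mem_of_forall_isMaxIdeal (fun x => ?_) fun M hM hIM => ?_)
  · convert ha x using 1
    rw [sub_mul, mul_sub, hzc x]
    abel
  · obtain ⟨p, hp, hpz, hpa⟩ := hM.exists_mem_jointSpectrum hIM ha
    have : p.1 z = p.2 := congrFun hg ⟨p, hp⟩
    have := hM.1.sub_mem hpa (this ▸ hpz z)
    simpa using this

end CStar

section NonUnital

variable {A : Type*} [NonUnitalCStarAlgebra A] {I : Set A}

local notation "ι" => (Unitization.inr : A → Unitization ℂ A)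

theorem IsIdealOf.image_inr (hI : IsIdealOf I Set.univ) : IsIdealOf (ι '' I) Set.univ := by
  refine ⟨Set.subset_univ _,
    (Unitization.isometry_inr (𝕜 := ℂ) (A := A)).isClosedEmbedding.isClosedMap _ hI.isClosed,
    ⟨0, hI.zero_mem, Unitization.inr_zero ℂ⟩, ?_, ?_, ?_⟩
  · rintro _ ⟨x, hx, rfl⟩ _ ⟨y, hy, rfl⟩
    exact ⟨x + y, hI.add_mem hx hy, Unitization.inr_add ℂ x y⟩
  · rintro _ ⟨x, hx, rfl⟩
    exact ⟨-x, hI.neg_mem hx, Unitization.inr_neg ℂ x⟩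
  · rintro _ ⟨x, hx, rfl⟩ u -
    induction u with
    | inl_add_inr c b =>
      refine ⟨⟨c • x + b * x, hI.add_mem (hI.smul_mem c hx) (hI.mul_mem_left b hx), ?_⟩,
        ⟨c • x + x * b, hI.add_mem (hI.smul_mem c hx) (hI.mul_mem_right b hx), ?_⟩⟩
      · rw [add_mul, Unitization.inl_mul_inr, ← Unitization.inr_mul, Unitization.inr_add]
      · rw [mul_add, Unitization.inr_mul_inl, ← Unitization.inr_mul, Unitization.inr_add]

theorem isIdealOf_univ : IsIdealOf (Set.univ : Set A) Set.univ :=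
  ⟨subset_rfl, isClosed_univ, trivial, fun _ _ _ _ => trivial, fun _ _ => trivial,
    fun _ _ _ _ => ⟨trivial, trivial⟩⟩

theorem IsIdealOf.preimage_inr {M : Set (Unitization ℂ A)} (hM : IsIdealOf M Set.univ) :
    IsIdealOf (ι ⁻¹' M) Set.univ := by
  refine ⟨Set.subset_univ _, hM.isClosed.preimage Unitization.isometry_inr.continuous, ?_,
    fun x hx y hy => ?_, fun x hx => ?_, fun x hx a _ => ⟨?_, ?_⟩⟩
  · simpa using hM.zero_mem
  · simpa using hM.add_mem hx hy
  · simpa using hM.neg_mem hx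
  · simpa using hM.mul_mem_left (ι a) hx
  · simpa using hM.mul_mem_right (ι a) hx

theorem inr_comm_of_mem_centerOf {z : A} (hz : z ∈ centerOf (Set.univ : Set A))
    (u : Unitization ℂ A) : ι z * u = u * ι z := by
  induction u with
  | inl_add_inr c b =>
    rw [add_mul, mul_add, Unitization.inl_mul_inr, Unitization.inr_mul_inl,
      ← Unitization.inr_mul, ← Unitization.inr_mul, hz.2 b trivial]

theorem IsMaxIdeal.eq_univ_of_ssubset {M : Set (Unitization ℂ A)} (hM : IsMaxIdeal M)
    (hI : IsIdealOf I Set.univ) (hMI : ι ⁻¹' M ⊆ I) (h : ¬ I ⊆ ι ⁻¹' M) : I = Set.univ := by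
  obtain ⟨_, ⟨j, hj, rfl⟩, hjM⟩ := hM.exists_one_sub_mem hI.image_inr
    (fun h' => h (Set.image_subset_iff.1 h'))
  refine Set.eq_univ_of_forall fun x => ?_
  have hx : x - x * j ∈ I := hMI <| by
    simpa [mul_sub] using hM.1.mul_mem_left (ι x) hjM
  simpa using hI.add_mem hx (hI.mul_mem_left x hj)

/-- Maximal ideals of the unitization not containing the algebra restrict to modular maximal
ideals. -/
theorem IsMaxIdeal.exists_isModMaxIdealOf {M : Set (Unitization ℂ A)} (hM : IsMaxIdeal M)
    (h : ¬ Set.range ι ⊆ M) :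
    IsModMaxIdealOf (ι ⁻¹' M) Set.univ ∧ ∃ e, IsRelUnitMod Set.univ (ι ⁻¹' M) e ∧
      ∀ (a : A) (c : ℂ), ι a - c • 1 ∈ M → a - c • e ∈ ι ⁻¹' M := by
  obtain ⟨_, ⟨e, -, rfl⟩, he⟩ := hM.exists_one_sub_mem isIdealOf_univ.image_inr
    (by rwa [Set.image_univ])
  have hrel : IsRelUnitMod Set.univ (ι ⁻¹' M) e := by
    refine ⟨trivial, fun x _ => ⟨?_, ?_⟩⟩
    · simpa [mul_sub] using hM.1.mul_mem_left (ι x) he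
    · simpa [sub_mul] using hM.1.mul_mem_right (ι x) he
  refine ⟨⟨hM.1.preimage_inr, fun h' => h ?_, fun J hJ hMJ => ?_, e, hrel⟩, e, hrel,
    fun a c hac => ?_⟩
  · exact Set.range_subset_iff.2 fun x => h'.ge (Set.mem_univ x)
  · by_cases hJM : J ⊆ ι ⁻¹' M
    · exact .inl (hJM.antisymm hMJ)
    · exact .inr (hM.eq_univ_of_ssubset hJ hMJ hJM)
  · have := hM.1.add_mem hac (hM.1.smul_mem c he)
    rw [smul_sub, sub_add_sub_cancel] at this
    simpa using this

theorem IsMaxIdeal.eq_zero_of_range_inr_subset {M : Set (Unitization ℂ A)} (hM : IsMaxIdeal M)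
    (h : Set.range ι ⊆ M) {a : A} {c : ℂ} (hac : ι a - c • 1 ∈ M) : c = 0 :=
  by_contra fun hc => hM.1.not_smul_one_mem hM.2.1 hc
    ((hM.1.mem_iff_of_sub_mem hac).1 (h ⟨a, rfl⟩))

theorem exists_isMaxIdeal_pair_inr (hI : IsIdealOf I Set.univ) {a : A}
    (ha : ∀ x, a * x - x * a ∈ I) (hlift : ∀ z ∈ centerOf (Set.univ : Set A), a - z ∉ I) :
    ∃ M₁ M₂ : Set (Unitization ℂ A), ∃ c₁ c₂ : ℂ, IsMaxIdeal M₁ ∧ IsMaxIdeal M₂ ∧ c₁ ≠ c₂ ∧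
      ι a - c₁ • 1 ∈ M₁ ∧ ι a - c₂ • 1 ∈ M₂ ∧
      ι ⁻¹' M₁ ∩ centerOf Set.univ = ι ⁻¹' M₂ ∩ centerOf Set.univ := by
  have hcomm : ∀ u : Unitization ℂ A, ι a * u - u * ι a ∈ ι '' I := fun u => by
    induction u with
    | inl_add_inr c b =>
      refine ⟨_, ha b, ?_⟩
      rw [add_mul, mul_add, Unitization.inl_mul_inr, Unitization.inr_mul_inl,
        ← Unitization.inr_mul, ← Unitization.inr_mul, Unitization.inr_sub]
      abel
  have hlift' : ∀ u : Unitization ℂ A, (∀ x, u * x = x * u) → ι a - u ∉ ι '' I := by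
    rintro u hu ⟨b, hb, hab⟩
    obtain rfl : u = ι (a - b) := by rw [Unitization.inr_sub, hab, sub_sub_cancel]
    refine hlift (a - b) ⟨trivial, fun x _ => ?_⟩ (by rwa [sub_sub_cancel])
    exact Unitization.inr_injective (R := ℂ) (by simpa using hu (ι x))
  obtain ⟨M₁, M₂, c₁, c₂, hM₁, hM₂, hne, h₁, h₂, hz⟩ :=
    exists_isMaxIdeal_pair hI.image_inr hcomm hlift'
  exact ⟨M₁, M₂, c₁, c₂, hM₁, hM₂, hne, h₁, h₂,
    Set.ext fun z => and_congr_left fun hzc => hz _ (inr_comm_of_mem_centerOf hzc)⟩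

theorem IsModMaxIdealOf.not_mem_of_isRelUnitMod (hM : IsModMaxIdealOf I Set.univ) {e : A}
    (he : IsRelUnitMod Set.univ I e) {c : ℂ} (hc : c ≠ 0) : c • e ∉ I := fun h => by
  refine hM.2.1 (Set.eq_univ_of_forall fun x => ?_)
  have h' : e ∈ I := by simpa [smul_smul, hc] using hM.1.smul_mem c⁻¹ h
  simpa using hM.1.add_mem (he.2 x trivial).1 (hM.1.mul_mem_left x h')

theorem IsRelUnitMod.commutator_mem (hI : IsIdealOf I Set.univ) {e : A}
    (he : IsRelUnitMod Set.univ I e) {a : A} {c : ℂ} (ha : a - c • e ∈ I) (x : A) :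
    a * x - x * a ∈ I := by
  have h₁ := hI.sub_mem (hI.mul_mem_right x ha) (hI.mul_mem_left x ha)
  have h₂ := hI.smul_mem c (hI.sub_mem (he.2 x trivial).1 (he.2 x trivial).2)
  convert hI.add_mem h₁ h₂ using 1
  simp only [sub_mul, mul_sub, smul_sub, smul_mul_assoc, mul_smul_comm]
  abel

theorem IsRelUnitMod.mul_sub_smul_mem (hI : IsIdealOf I Set.univ) {e : A}
    (he : IsRelUnitMod Set.univ I e) {a z w : A} {c : ℂ} (ha : a - c • e ∈ I)
    (haz : a - z ∈ I) : w * z - c • w ∈ I := by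
  have h₁ := hI.mul_mem_left w (hI.sub_mem ha haz)
  have h₂ := hI.smul_mem c (he.2 w trivial).1
  convert hI.sub_mem h₁ h₂ using 1
  simp only [mul_sub, smul_sub, mul_smul_comm]
  abel

theorem mul_sub_smul_mem_centerOf {z w : A} (hz : z ∈ centerOf (Set.univ : Set A))
    (hw : w ∈ centerOf (Set.univ : Set A)) (c : ℂ) :
    w * z - c • w ∈ centerOf (Set.univ : Set A) :=
  ⟨trivial, fun x _ => by
    rw [sub_mul, mul_sub, smul_mul_assoc, mul_smul_comm, hw.2 x trivial, mul_assoc,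
      hz.2 x trivial, ← mul_assoc, hw.2 x trivial, mul_assoc]⟩

theorem IsIdealOf.inter {J : Set A} (hI : IsIdealOf I Set.univ) (hJ : IsIdealOf J Set.univ) :
    IsIdealOf (I ∩ J) Set.univ :=
  ⟨Set.subset_univ _, hI.isClosed.inter hJ.isClosed, ⟨hI.zero_mem, hJ.zero_mem⟩,
    fun _ hx _ hy => ⟨hI.add_mem hx.1 hy.1, hJ.add_mem hx.2 hy.2⟩,
    fun _ hx => ⟨hI.neg_mem hx.1, hJ.neg_mem hx.2⟩,
    fun _ hx a _ => ⟨⟨hI.mul_mem_left a hx.1, hJ.mul_mem_left a hx.2⟩,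
      ⟨hI.mul_mem_right a hx.1, hJ.mul_mem_right a hx.2⟩⟩⟩

end NonUnital

end CQP


open CQP

/-- **Theorem 4.8.** For any C*-algebra `A`, the set `V_A = A \ CQ(A)` of elements
preventing the CQ-property equals `V_A¹ ∪ V_A²`, where
`V_A¹` consists of those `a` for which there is `M ∈ Max(A)` with `Z(A) ⊆ M` and
`a + M` a non-zero scalar in `A/M`, and
`V_A²` consists of those `a` for which there are `M₁, M₂ ∈ Max(A)` and scalars
`λ₁ ≠ λ₂` with `Z(A) ⊄ Mᵢ`, `M₁ ∩ Z(A) = M₂ ∩ Z(A)` and `a + Mᵢ = λᵢ·1` in `A/Mᵢ`. -/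
theorem stmt16 {A : Type*} [NonUnitalCStarAlgebra A] :
    (Set.univ : Set A) \ CQset (Set.univ : Set A) =
      {a : A | ∃ M : Set A, IsModMaxIdealOf M (Set.univ : Set A) ∧
        centerOf (Set.univ : Set A) ⊆ M ∧
        ∃ (lam : ℂ) (e : A), lam ≠ 0 ∧ IsRelUnitMod (Set.univ : Set A) M e ∧
          a - lam • e ∈ M} ∪
      {a : A | ∃ M₁ M₂ : Set A, IsModMaxIdealOf M₁ (Set.univ : Set A) ∧
        IsModMaxIdealOf M₂ (Set.univ : Set A) ∧
        ¬ centerOf (Set.univ : Set A) ⊆ M₁ ∧ ¬ centerOf (Set.univ : Set A) ⊆ M₂ ∧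
        M₁ ∩ centerOf (Set.univ : Set A) = M₂ ∩ centerOf (Set.univ : Set A) ∧
        ∃ (lam₁ lam₂ : ℂ) (e₁ e₂ : A), lam₁ ≠ lam₂ ∧
          IsRelUnitMod (Set.univ : Set A) M₁ e₁ ∧
          IsRelUnitMod (Set.univ : Set A) M₂ e₂ ∧
          a - lam₁ • e₁ ∈ M₁ ∧ a - lam₂ • e₂ ∈ M₂} := by
  ext a
  constructor
  · rintro ⟨-, ha⟩
    obtain ⟨I, hI, hcomm, hlift⟩ : ∃ I, IsIdealOf I (Set.univ : Set A) ∧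
        (∀ x, a * x - x * a ∈ I) ∧ ∀ z ∈ centerOf (Set.univ : Set A), a - z ∉ I := by
      by_contra! hcon
      exact ha ⟨trivial, fun I hI h => hcon I hI fun x => h x trivial⟩
    obtain ⟨M₁, M₂, c₁, c₂, hM₁, hM₂, hne, h₁, h₂, hZ⟩ :=
      exists_isMaxIdeal_pair_inr hI hcomm hlift
    have hsub {M N : Set (Unitization ℂ A)} (h : Unitization.inr ⁻¹' M ∩ centerOf Set.univ =
        Unitization.inr ⁻¹' N ∩ centerOf Set.univ)
        (hM : centerOf (Set.univ : Set A) ⊆ Unitization.inr ⁻¹' M) :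
        centerOf (Set.univ : Set A) ⊆ Unitization.inr ⁻¹' N := fun z hz =>
      (h.le ⟨hM hz, hz⟩).1
    have first {M : Set (Unitization ℂ A)} {c : ℂ} (hM : IsMaxIdeal M) (hc : c ≠ 0)
        (h : (a : Unitization ℂ A) - c • 1 ∈ M)
        (hZ : centerOf (Set.univ : Set A) ⊆ Unitization.inr ⁻¹' M) :
        ∃ M : Set A, IsModMaxIdealOf M (Set.univ : Set A) ∧
          centerOf (Set.univ : Set A) ⊆ M ∧
          ∃ (lam : ℂ) (e : A), lam ≠ 0 ∧ IsRelUnitMod (Set.univ : Set A) M e ∧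
            a - lam • e ∈ M := by
      obtain ⟨hmax, e, he, hae⟩ := hM.exists_isModMaxIdealOf fun hr =>
        hc (hM.eq_zero_of_range_inr_subset hr h)
      exact ⟨_, hmax, hZ, c, e, hc, he, hae a c h⟩
    by_cases hZ₁ : centerOf (Set.univ : Set A) ⊆ Unitization.inr ⁻¹' M₁
    · by_cases hc : c₁ = 0
      · exact .inl (first hM₂ (hc ▸ hne.symm) h₂ (hsub hZ hZ₁))
      · exact .inl (first hM₁ hc h₁ hZ₁)
    · have hZ₂ := mt (hsub hZ.symm) hZ₁
      obtain ⟨hmax₁, e₁, he₁, hae₁⟩ := hM₁.exists_isModMaxIdealOf fun hr =>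
        hZ₁ fun z _ => hr ⟨z, rfl⟩
      obtain ⟨hmax₂, e₂, he₂, hae₂⟩ := hM₂.exists_isModMaxIdealOf fun hr =>
        hZ₂ fun z _ => hr ⟨z, rfl⟩
      exact .inr ⟨_, _, hmax₁, hmax₂, hZ₁, hZ₂, hZ, c₁, c₂, e₁, e₂, hne, he₁, he₂,
        hae₁ a c₁ h₁, hae₂ a c₂ h₂⟩
  · rintro (⟨M, hM, hZ, c, e, hc, he, hae⟩ |
      ⟨M₁, M₂, hM₁, hM₂, hZ₁, -, hZ, c₁, c₂, e₁, e₂, hne, he₁, he₂, h₁, h₂⟩)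
    · refine ⟨trivial, fun ⟨_, ha⟩ => hM.not_mem_of_isRelUnitMod he hc ?_⟩
      obtain ⟨z, hz, haz⟩ := ha M hM.1 fun x _ => he.commutator_mem hM.1 hae x
      exact (hM.1.mem_iff_of_sub_mem hae).1 ((hM.1.mem_iff_of_sub_mem haz).2 (hZ hz))
    · refine ⟨trivial, fun ⟨_, ha⟩ => ?_⟩
      obtain ⟨z, hz, haz₁, haz₂⟩ := ha (M₁ ∩ M₂) (hM₁.1.inter hM₂.1) fun x _ =>
        ⟨he₁.commutator_mem hM₁.1 h₁ x, he₂.commutator_mem hM₂.1 h₂ x⟩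
      obtain ⟨w, hw, hwM⟩ := Set.not_subset.1 hZ₁
      refine hwM (hZ.ge ⟨?_, hw⟩).1
      have hw₁ := (hZ.le ⟨he₁.mul_sub_smul_mem hM₁.1 h₁ haz₁ (w := w),
        mul_sub_smul_mem_centerOf hz hw c₁⟩).1
      have hw₂ := he₂.mul_sub_smul_mem hM₂.1 h₂ haz₂ (w := w)
      have := hM₂.1.smul_mem (c₁ - c₂)⁻¹ (hM₂.1.sub_mem hw₂ hw₁)
      rwa [sub_sub_sub_cancel_left, ← sub_smul, smul_smul,
        inv_mul_cancel₀ (sub_ne_zero.2 hne), one_smul] at this
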